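/- For every tree T on n ≥ 2 vertices, W_e(T) ≤ (1/6)n³ − (1/2)n² + (1/3)n = n(n−1)(n−2)/6, with equality if and only if T is isomorphic to the path P_n on n vertices. -/

import Mathlib

open SimpleGraph Finset
open scoped Classical

/-- The distance `d_G(f,g)` between two edges: `0` if they coincide, otherwise the minimum
distance between endpoints plus one (i.e. the distance in the line graph). -/
noncomputable def eDist {V : Type*} (G : SimpleGraph V) (e f : Sym2 V) : ℕ :=
  if e = f then 0 else sInf {n : ℕ | ∃ u ∈ e, ∃ w ∈ f, G.dist u w = n} + 1

/-- The distance `d_G(v,f)` between a vertex and an edge: the minimum distance to an endpoint. -/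
noncomputable def vDist {V : Type*} (G : SimpleGraph V) (v : V) (e : Sym2 V) : ℕ :=
  sInf {n : ℕ | ∃ u ∈ e, G.dist v u = n}

/-- The edge-Wiener index `W_e(G)`: the sum of `eDist` over unordered pairs of edges. -/
noncomputable def edgeWiener {V : Type*} [Fintype V] (G : SimpleGraph V) : ℕ :=
  (∑ e ∈ G.edgeFinset, ∑ f ∈ G.edgeFinset, eDist G e f) / 2

/-- In a tree, the neighbour of `a` closer to `b` is unique. -/
lemma closer_unique {V : Type*} {T : SimpleGraph V} (hconn : T.Connected) (hac : T.IsAcyclic)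
    {a b c c' : V} (h : T.Adj a c) (h' : T.Adj a c')
    (hd : T.dist c b + 1 = T.dist a b) (hd' : T.dist c' b + 1 = T.dist a b) : c = c' := by
  obtain ⟨p, hp⟩ := hconn.exists_walk_length_eq_dist c b
  obtain ⟨q, hq⟩ := hconn.exists_walk_length_eq_dist c' b
  have h1 : (Walk.cons h p).IsPath :=
    Walk.isPath_of_length_eq_dist _ (by simp [hp, hd])
  have h2 : (Walk.cons h' q).IsPath :=
    Walk.isPath_of_length_eq_dist _ (by simp [hq, hd'])
  have h3 := hac.path_unique ⟨_, h1⟩ ⟨_, h2⟩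
  have h4 : Walk.cons h p = Walk.cons h' q := congrArg Subtype.val h3
  simpa using congrArg Walk.snd h4

lemma exists_closer {V : Type*} {T : SimpleGraph V} (hconn : T.Connected)
    {a b : V} (hab : a ≠ b) : ∃ c, T.Adj a c ∧ T.dist c b + 1 = T.dist a b := by
  obtain ⟨p, hp⟩ := hconn.exists_walk_length_eq_dist a b
  cases p with
  | nil => exact absurd rfl hab
  | @cons _ c _ h p =>
    refine ⟨c, h, ?_⟩
    have h1 := dist_le p
    have h2 := hconn.dist_triangle (u := a) (v := c) (w := b)
    have h3 := dist_eq_one_iff_adj.mpr h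
    simp at hp
    omega

lemma adj_dist {V : Type*} {T : SimpleGraph V} (hconn : T.Connected) (hac : T.IsAcyclic)
    {a c : V} (h : T.Adj a c) (b : V) :
    T.dist c b + 1 = T.dist a b ∨ T.dist a b + 1 = T.dist c b := by
  have := (IsTree.mk hconn hac).dist_eq_dist_add_one_of_adj b h
  rw [dist_comm (u := c), dist_comm (u := a)]
  omega

lemma eDist_le {V : Type*} {T : SimpleGraph V} {e f : Sym2 V} {u w : V} (hu : u ∈ e)
    (hw : w ∈ f) : eDist T e f ≤ T.dist u w + 1 := by
  unfold eDist
  split_ifs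
  · omega
  · have : sInf {n : ℕ | ∃ u ∈ e, ∃ w ∈ f, T.dist u w = n} ≤ T.dist u w :=
      Nat.sInf_le ⟨u, hu, w, hw, rfl⟩
    omega

lemma core {V : Type*} {T : SimpleGraph V} (hconn : T.Connected) (hac : T.IsAcyclic)
    {a a' b b' : V} (h : T.Adj a a') (h' : T.Adj b b') (hne : s(a, a') ≠ s(b, b'))
    (h1 : T.dist a' b ≤ T.dist a b) (h2 : T.dist a b' ≤ T.dist a b) :
    T.dist a' b + 1 = T.dist a b ∧ T.dist b' a + 1 = T.dist b a ∧
      eDist T s(a, a') s(b, b') + 1 ≤ T.dist a b := by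
  have e1 : T.dist a' b + 1 = T.dist a b := by
    have := adj_dist hconn hac h b; omega
  have e2 : T.dist b' a + 1 = T.dist b a := by
    have := adj_dist hconn hac h' a
    rw [dist_comm (u := b') (v := a), dist_comm (u := b) (v := a)] at *
    omega
  refine ⟨e1, e2, ?_⟩
  have hab' : a ≠ b' := by
    rintro rfl
    have h3 : T.dist b a = 1 := by rw [← e2]; simp
    have h4 : T.dist a' b = 0 := by rw [dist_comm] at h3; omega
    have := hconn.dist_eq_zero_iff.mp h4
    subst this
    exact hne Sym2.eq_swap
  obtain ⟨c, hc, hcd⟩ := exists_closer hconn hab'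
  have h5 : T.dist c b + 1 = T.dist a b := by
    have t := hconn.dist_triangle (u := c) (v := b') (w := b)
    have t2 := dist_eq_one_iff_adj.mpr h'.symm
    have := adj_dist hconn hac hc b
    rw [dist_comm (u := b') (v := a), dist_comm (u := b) (v := a)] at e2
    omega
  have := closer_unique hconn hac hc h h5 e1
  subst this
  have h6 := eDist_le (T := T) (Sym2.mem_mk_right a c) (Sym2.mem_mk_right b b')
  rw [dist_comm (u := b') (v := a), dist_comm (u := b) (v := a)] at e2
  omega

lemma exists_far {V : Type*} {T : SimpleGraph V} (hconn : T.Connected) (hac : T.IsAcyclic)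
    (e f : Sym2 V) (he : e ∈ T.edgeSet) (hf : f ∈ T.edgeSet) (hne : e ≠ f) :
    ∃ p : V × V, (∃ c, T.Adj p.1 c ∧ e = s(p.1, c) ∧ T.dist c p.2 + 1 = T.dist p.1 p.2) ∧
      (∃ c, T.Adj p.2 c ∧ f = s(p.2, c) ∧ T.dist c p.1 + 1 = T.dist p.2 p.1) ∧
      eDist T e f ≤ T.dist p.1 p.2 - 1 := by
  induction e with | _ u v
  induction f with | _ w z
  rw [mem_edgeSet] at he hf
  have key : ∀ a a' b b' : V, s(u, v) = s(a, a') → s(w, z) = s(b, b') → 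
      T.dist a' b ≤ T.dist a b → T.dist a b' ≤ T.dist a b →
      ∃ p : V × V,
      (∃ c, T.Adj p.1 c ∧ s(u, v) = s(p.1, c) ∧ T.dist c p.2 + 1 = T.dist p.1 p.2) ∧
      (∃ c, T.Adj p.2 c ∧ s(w, z) = s(p.2, c) ∧ T.dist c p.1 + 1 = T.dist p.2 p.1) ∧
      eDist T s(u, v) s(w, z) ≤ T.dist p.1 p.2 - 1 := by
    intro a a' b b' h1 h2 h3 h4
    have ha : T.Adj a a' := by rw [← mem_edgeSet, ← h1]; exact he
    have hb : T.Adj b b' := by rw [← mem_edgeSet, ← h2]; exact hf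
    have hne' : s(a, a') ≠ s(b, b') := by rw [← h1, ← h2]; exact hne
    obtain ⟨k1, k2, k3⟩ := core hconn hac ha hb hne' h3 h4
    refine ⟨(a, b), ⟨a', ha, h1, k1⟩, ⟨b', hb, h2, k2⟩, ?_⟩
    rw [h1, h2]; simp only; omega
  have k1 := key u v w z rfl rfl
  have k2 := key u v z w rfl Sym2.eq_swap
  have k3 := key v u w z Sym2.eq_swap rfl
  have k4 := key v u z w Sym2.eq_swap Sym2.eq_swap
  by_cases c1 : T.dist v w ≤ T.dist u w ∧ T.dist u z ≤ T.dist u w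
  · exact k1 c1.1 c1.2
  by_cases c2 : T.dist v z ≤ T.dist u z ∧ T.dist u w ≤ T.dist u z
  · exact k2 c2.1 c2.2
  by_cases c3 : T.dist u w ≤ T.dist v w ∧ T.dist v z ≤ T.dist v w
  · exact k3 c3.1 c3.2
  exact k4 (by omega) (by omega)

lemma sum_eDist_le {V : Type*} [Fintype V] (T : SimpleGraph V)
    (hconn : T.Connected) (hac : T.IsAcyclic) :
    ∑ e ∈ T.edgeFinset, ∑ f ∈ T.edgeFinset, eDist T e f ≤
      ∑ a : V, ∑ b : V, (T.dist a b - 1) := by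
  have key : ∀ q : Sym2 V × Sym2 V, ∃ p : V × V,
      q ∈ (T.edgeFinset ×ˢ T.edgeFinset).filter (fun q => q.1 ≠ q.2) →
      (∃ c, T.Adj p.1 c ∧ q.1 = s(p.1, c) ∧ T.dist c p.2 + 1 = T.dist p.1 p.2) ∧
      (∃ c, T.Adj p.2 c ∧ q.2 = s(p.2, c) ∧ T.dist c p.1 + 1 = T.dist p.2 p.1) ∧
      eDist T q.1 q.2 ≤ T.dist p.1 p.2 - 1 := by
    intro q
    by_cases hq : q ∈ (T.edgeFinset ×ˢ T.edgeFinset).filter (fun q => q.1 ≠ q.2)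
    · have hq' := hq
      simp only [Finset.mem_filter, Finset.mem_product, mem_edgeFinset] at hq'
      obtain ⟨p, hp⟩ := exists_far hconn hac q.1 q.2 hq'.1.1 hq'.1.2 hq'.2
      exact ⟨p, fun _ => hp⟩
    · obtain ⟨v⟩ := hconn.nonempty
      exact ⟨(v, v), fun h => absurd h hq⟩
  choose g hg using key
  rw [← Finset.sum_product', ← Finset.sum_product']
  have h0 : ∑ q ∈ T.edgeFinset ×ˢ T.edgeFinset, eDist T q.1 q.2 =
      ∑ q ∈ (T.edgeFinset ×ˢ T.edgeFinset).filter (fun q => q.1 ≠ q.2), eDist T q.1 q.2 := by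
    symm
    apply Finset.sum_filter_of_ne
    intro q _ h h2
    apply h
    simp [eDist, h2]
  rw [h0]
  set P := (T.edgeFinset ×ˢ T.edgeFinset).filter (fun q => q.1 ≠ q.2) with hP
  have hinj : Set.InjOn g P := by
    intro q hq r hr hqr
    obtain ⟨⟨c, c1, c2, c3⟩, ⟨d, d1, d2, d3⟩, _⟩ := hg q hq
    obtain ⟨⟨c', c1', c2', c3'⟩, ⟨d', d1', d2', d3'⟩, _⟩ := hg r hr
    rw [← hqr] at c1' c2' c3' d1' d2' d3'
    have e1 := closer_unique hconn hac c1 c1' c3 c3'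
    have e2 := closer_unique hconn hac d1 d1' d3 d3'
    apply Prod.ext
    · rw [c2, c2', e1]
    · rw [d2, d2', e2]
  calc ∑ q ∈ P, eDist T q.1 q.2 ≤ ∑ q ∈ P, (T.dist (g q).1 (g q).2 - 1) :=
        Finset.sum_le_sum fun q hq => (hg q hq).2.2
    _ = ∑ p ∈ P.image g, (T.dist p.1 p.2 - 1) := by rw [Finset.sum_image hinj]
    _ ≤ _ := Finset.sum_le_sum_of_subset (by intro x _; simp)

/-- `x` lies strictly between `a` and `b`. -/
def TBtw {V : Type*} (T : SimpleGraph V) (a x b : V) : Prop :=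
  x ≠ a ∧ x ≠ b ∧ a ≠ b ∧ T.dist a x + T.dist x b = T.dist a b

lemma exists_tree_between {V : Type*} {T : SimpleGraph V} (hconn : T.Connected)
    (a b : V) (i : ℕ) (hi : i ≤ T.dist a b) :
    ∃ x, T.dist a x = i ∧ T.dist a x + T.dist x b = T.dist a b := by
  obtain ⟨p, hp⟩ := hconn.exists_walk_length_eq_dist a b
  have h1 := dist_le (p.take i)
  have h2 := dist_le (p.drop i)
  have h3 := hconn.dist_triangle (u := a) (v := p.getVert i) (w := b)
  rw [Walk.take_length] at h1
  rw [Walk.drop_length] at h2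
  refine ⟨p.getVert i, ?_, ?_⟩ <;> omega

lemma dist_le_card {V : Type*} [Fintype V] {T : SimpleGraph V} (hconn : T.Connected) (a b : V) :
    T.dist a b - 1 ≤ ∑ x : V, if TBtw T a x b then 1 else 0 := by
  rw [← Finset.card_filter]
  have : ∀ i : ℕ, ∃ x, i ≤ T.dist a b →
      T.dist a x = i ∧ T.dist a x + T.dist x b = T.dist a b := by
    intro i
    by_cases hi : i ≤ T.dist a b
    · obtain ⟨x, hx⟩ := exists_tree_between hconn a b i hi
      exact ⟨x, fun _ => hx⟩
    · exact ⟨a, fun h => absurd h hi⟩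
  choose g hg using this
  have h : (Finset.Ioo 0 (T.dist a b)).card ≤ (Finset.univ.filter (fun x => TBtw T a x b)).card := by
    apply Finset.card_le_card_of_injOn g
    · intro i hi
      simp only [Finset.coe_Ioo, Set.mem_Ioo] at hi
      obtain ⟨h1, h2⟩ := hg i hi.2.le
      simp only [Finset.coe_filter, Finset.mem_univ, true_and, Set.mem_setOf_eq]
      refine ⟨?_, ?_, ?_, h2⟩
      · intro h; rw [h] at h1; simp at h1; omega
      · intro h; rw [h] at h1; omega
      · intro h; rw [h] at hi; simp at hi
    · intro i hi j hj hij
      simp only [Finset.coe_Ioo, Set.mem_Ioo] at hi hj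
      have h1 := (hg i hi.2.le).1
      have h2 := (hg j hj.2.le).1
      rw [← h1, ← h2, hij]
  simpa using h

lemma sum_distinct {V : Type*} [Fintype V] (hn : 2 ≤ Fintype.card V) :
    ∑ a : V, ∑ b : V, ∑ x : V, (if x ≠ a ∧ x ≠ b ∧ a ≠ b then 1 else 0) =
      Fintype.card V * ((Fintype.card V - 1) * (Fintype.card V - 2)) := by
  have h1 : ∀ a b : V, ∑ x : V, (if x ≠ a ∧ x ≠ b ∧ a ≠ b then 1 else 0) =
      if b ≠ a then Fintype.card V - 2 else 0 := by
    intro a b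
    rw [← Finset.card_filter]
    split_ifs with h
    · have : Finset.univ.filter (fun x => x ≠ a ∧ x ≠ b ∧ a ≠ b) = ({a, b} : Finset V)ᶜ := by
        ext x; simp [h.symm]
      rw [this, Finset.card_compl, Finset.card_pair h.symm]
    · push Not at h
      simp [h]
  have h2 : ∀ a : V, ∑ b : V, (if b ≠ a then Fintype.card V - 2 else 0) =
      (Fintype.card V - 1) * (Fintype.card V - 2) := by
    intro a
    rw [← Finset.sum_filter, Finset.sum_const, Finset.filter_ne', Finset.card_erase_of_mem (by simp)]
    simp
  simp_rw [h1, h2]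
  simp

lemma sum_rot {V : Type*} [Fintype V] (F : V → V → V → ℕ) :
    ∑ a : V, ∑ b : V, ∑ x : V, F a x b = ∑ a : V, ∑ b : V, ∑ x : V, F a b x := by
  refine Finset.sum_congr rfl fun a _ => Finset.sum_comm

lemma btw_le {V : Type*} {T : SimpleGraph V} (hconn : T.Connected) (a b x : V) :
    (if TBtw T a x b then 1 else 0) + (if TBtw T a b x then 1 else 0) + (if TBtw T b a x then 1 else 0)
      ≤ (if x ≠ a ∧ x ≠ b ∧ a ≠ b then 1 else 0) := by
  have p1 : x ≠ a → 0 < T.dist a x := fun h => hconn.pos_dist_of_ne h.symm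
  have p2 : x ≠ b → 0 < T.dist b x := fun h => hconn.pos_dist_of_ne h.symm
  have p3 : a ≠ b → 0 < T.dist a b := fun h => hconn.pos_dist_of_ne h
  unfold TBtw
  rw [dist_comm (u := x) (v := b), dist_comm (u := b) (v := a)]
  by_cases h1 : x = a
  · simp [h1]
  by_cases h2 : x = b
  · simp [h2]
  by_cases h3 : a = b
  · simp [h3]
  have := p1 h1
  have := p2 h2
  have := p3 h3
  simp only [ne_eq, h1, h2, h3, Ne.symm h1, Ne.symm h2, Ne.symm h3, not_false_eq_true, true_and,
    Ne.symm (a := a) (b := b), eq_comm (a := a) (b := x), eq_comm (a := b) (b := x), 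
    eq_comm (a := b) (b := a), if_true]
  split_ifs <;> omega

lemma three_sum {V : Type*} [Fintype V] (T : SimpleGraph V) :
    3 * ∑ a : V, ∑ b : V, ∑ x : V, (if TBtw T a x b then 1 else 0) =
    ∑ a : V, ∑ b : V, ∑ x : V,
      ((if TBtw T a x b then 1 else 0) + (if TBtw T a b x then 1 else 0) +
        (if TBtw T b a x then 1 else 0)) := by
  simp_rw [Finset.sum_add_distrib]
  have h1 := sum_rot (fun a x b : V => if TBtw T a x b then 1 else 0)
  have h2 : ∑ a : V, ∑ b : V, ∑ x : V, (if TBtw T b a x then 1 else 0) =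
      ∑ a : V, ∑ b : V, ∑ x : V, (if TBtw T a b x then 1 else 0) := Finset.sum_comm
  rw [h2, ← h1]; ring

lemma sum_bound {V : Type*} [Fintype V] (T : SimpleGraph V)
    (hconn : T.Connected) (hac : T.IsAcyclic) (hn : 2 ≤ Fintype.card V) :
    3 * ∑ e ∈ T.edgeFinset, ∑ f ∈ T.edgeFinset, eDist T e f ≤
      Fintype.card V * ((Fintype.card V - 1) * (Fintype.card V - 2)) ∧
    (3 * ∑ e ∈ T.edgeFinset, ∑ f ∈ T.edgeFinset, eDist T e f =
      Fintype.card V * ((Fintype.card V - 1) * (Fintype.card V - 2)) →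
      ∀ a b x : V, x ≠ a → x ≠ b → a ≠ b → TBtw T a x b ∨ TBtw T a b x ∨ TBtw T b a x) := by
  have h1 := sum_eDist_le T hconn hac
  have h2 : ∑ a : V, ∑ b : V, (T.dist a b - 1) ≤
      ∑ a : V, ∑ b : V, ∑ x : V, (if TBtw T a x b then 1 else 0) :=
    Finset.sum_le_sum fun a _ => Finset.sum_le_sum fun b _ => dist_le_card hconn a b
  have h3 := three_sum T
  rw [← sum_distinct hn]
  have h4 := btw_le hconn
  have h5 : ∑ a : V, ∑ b : V, ∑ x : V,
      ((if TBtw T a x b then 1 else 0) + (if TBtw T a b x then 1 else 0) +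
        (if TBtw T b a x then 1 else 0)) ≤
      ∑ a : V, ∑ b : V, ∑ x : V, (if x ≠ a ∧ x ≠ b ∧ a ≠ b then 1 else 0) :=
    Finset.sum_le_sum fun a _ => Finset.sum_le_sum fun b _ => Finset.sum_le_sum fun x _ => h4 a b x
  refine ⟨by omega, fun heq a b x hxa hxb hab => ?_⟩
  by_contra hcon
  push Not at hcon
  have h6 : ∑ a : V, ∑ b : V, ∑ x : V,
      ((if TBtw T a x b then 1 else 0) + (if TBtw T a b x then 1 else 0) +
        (if TBtw T b a x then 1 else 0)) <
      ∑ a : V, ∑ b : V, ∑ x : V, (if x ≠ a ∧ x ≠ b ∧ a ≠ b then 1 else 0) := by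
    refine Finset.sum_lt_sum (fun a _ => Finset.sum_le_sum fun b _ =>
      Finset.sum_le_sum fun x _ => h4 a b x) ⟨a, Finset.mem_univ _, ?_⟩
    refine Finset.sum_lt_sum (fun b _ => Finset.sum_le_sum fun x _ => h4 a b x)
      ⟨b, Finset.mem_univ _, ?_⟩
    refine Finset.sum_lt_sum (fun x _ => h4 a b x) ⟨x, Finset.mem_univ _, ?_⟩
    simp [hcon.1, hcon.2.1, hcon.2.2, hxa, hxb, hab]
  omega

lemma path_of_collinear {V : Type*} [Fintype V] (T : SimpleGraph V)
    (hconn : T.Connected) (hac : T.IsAcyclic) (hn : 2 ≤ Fintype.card V)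
    (hcol : ∀ a b x : V, x ≠ a → x ≠ b → a ≠ b → TBtw T a x b ∨ TBtw T a b x ∨ TBtw T b a x) :
    Nonempty (T ≃g SimpleGraph.pathGraph (Fintype.card V)) := by
  have := hconn.nonempty
  obtain ⟨⟨a, b⟩, hmax⟩ := Finite.exists_max (fun p : V × V => T.dist p.1 p.2)
  have hmax' : ∀ x y, T.dist x y ≤ T.dist a b := fun x y => hmax (x, y)
  have hpos : ∀ {x y : V}, x ≠ y → 0 < T.dist x y := fun h => hconn.pos_dist_of_ne h
  have hab : a ≠ b := by
    have : Nontrivial V := Fintype.one_lt_card_iff_nontrivial.mp (by omega)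
    obtain ⟨x, y, hxy⟩ := exists_pair_ne V
    rintro rfl
    have h1 := hmax' x y
    have h2 := hpos hxy
    rw [SimpleGraph.dist_self] at h1
    omega
  have hbtw : ∀ x, T.dist a x + T.dist x b = T.dist a b := by
    intro x
    by_cases h1 : x = a
    · simp [h1]
    by_cases h2 : x = b
    · simp [h2]
    have q1 := hpos h1
    have q2 := hpos h2
    have q3 := hmax' a x
    have q4 := hmax' b x
    have q5 := T.dist_comm (u := x) (v := b)
    have q6 := T.dist_comm (u := x) (v := a)
    have q7 := T.dist_comm (u := b) (v := a)
    rcases hcol a b x h1 h2 hab with h | h | h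
    · exact h.2.2.2
    · have := h.2.2.2
      omega
    · have := h.2.2.2
      omega
  have hinj : ∀ x y, T.dist a x = T.dist a y → x = y := by
    intro x y hxy
    by_contra hne
    have q0 := hpos hne
    have hx := hbtw x
    have hy := hbtw y
    have hxa : x ≠ a := by
      rintro rfl
      rw [SimpleGraph.dist_self] at hxy
      rw [eq_comm, hconn.dist_eq_zero_iff] at hxy
      exact hne hxy
    have hya : y ≠ a := by
      rintro rfl
      rw [SimpleGraph.dist_self] at hxy
      rw [hconn.dist_eq_zero_iff] at hxy
      exact hne hxy.symm
    have c1 := T.dist_comm (u := x) (v := a)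
    have c2 := T.dist_comm (u := y) (v := a)
    have c3 := T.dist_comm (u := x) (v := y)
    have c4 := T.dist_comm (u := b) (v := x)
    have c5 := T.dist_comm (u := b) (v := y)
    have k1 : T.dist x y = 2 * T.dist a x := by
      rcases hcol x y a hxa.symm hya.symm hne with h | h | h <;>
      · have := h.2.2.2
        omega
    have hxb : x ≠ b := by
      rintro rfl
      have : T.dist y x = 0 := by simp at hx; omega
      exact hne (hconn.dist_eq_zero_iff.mp this).symm
    have hyb : y ≠ b := by
      rintro rfl
      have : T.dist x y = 0 := by simp at hy; omega
      omega
    obtain ⟨c, hc1, hc2⟩ := exists_closer hconn hxa.symm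
    obtain ⟨d, hd1, hd2⟩ := exists_closer hconn hya.symm
    have t1 := hconn.dist_triangle (u := c) (v := x) (w := b)
    have t2 := hconn.dist_triangle (u := d) (v := y) (w := b)
    have e1 := adj_dist hconn hac hc1 b
    have e2 := adj_dist hconn hac hd1 b
    have : c = d := closer_unique hconn hac (b := b) hc1 hd1 (by omega) (by omega)
    subst this
    have t3 := hconn.dist_triangle (u := x) (v := c) (w := y)
    have c6 := T.dist_comm (u := x) (v := c)
    omega
  have hlt : ∀ x, T.dist a x < Fintype.card V := by
    intro x
    obtain ⟨p, hp, hp2⟩ := hconn.exists_path_of_dist a x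
    rw [← hp2]
    exact hp.length_lt
  let φ : V → Fin (Fintype.card V) := fun x => ⟨T.dist a x, hlt x⟩
  have hφ : Function.Injective φ := fun x y h => hinj x y (by simpa [φ] using h)
  have hbij : Function.Bijective φ := by
    rw [Fintype.bijective_iff_injective_and_card]
    exact ⟨hφ, by simp⟩
  have hstep : ∀ x y, T.dist a x + 1 = T.dist a y → T.Adj x y := by
    intro x y h
    have hya : y ≠ a := by rintro rfl; simp at h
    obtain ⟨c, hc1, hc2⟩ := exists_closer hconn hya
    rw [dist_comm (u := c), dist_comm (u := y)] at hc2
    have := hinj c x (by omega)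
    subst this
    exact hc1.symm
  refine ⟨⟨Equiv.ofBijective φ hbij, ?_⟩⟩
  intro x y
  simp only [Equiv.ofBijective_apply, pathGraph_adj, φ]
  constructor
  · rintro (h | h)
    · exact hstep x y h
    · exact (hstep y x h).symm
  · intro h
    have := adj_dist hconn hac h a
    rw [dist_comm (u := y), dist_comm (u := x)] at this
    omega

lemma walk_length_ge {V : Type*} {T : SimpleGraph V} {n : ℕ} (φ : T ≃g SimpleGraph.pathGraph n)
    {u v : V} (p : T.Walk u v) : (φ v : ℕ) ≤ φ u + p.length ∧ (φ u : ℕ) ≤ φ v + p.length := by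
  induction p with
  | nil => simp
  | cons h p ih =>
    have := φ.map_rel_iff.mpr h
    rw [pathGraph_adj] at this
    simp only [Walk.length_cons]
    omega

lemma sum_absdiff (m : ℕ) :
    3 * ∑ i ∈ Finset.range m, ∑ j ∈ Finset.range m, ((i - j) + (j - i)) =
      (m + 1) * (m * (m - 1)) := by
  induction m with
  | zero => simp
  | succ m ih =>
    have h1 : ∀ k, 2 * ∑ i ∈ Finset.range k, (k - i) = k * (k + 1) := by
      intro k
      induction k with
      | zero => simp
      | succ k ihk =>
        rw [Finset.sum_range_succ']
        simp only [Nat.add_sub_add_right]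
        simp only [Nat.sub_zero]
        nlinarith
    have e1 : ∑ i ∈ Finset.range m, ((i - m) + (m - i)) = ∑ i ∈ Finset.range m, (m - i) :=
      Finset.sum_congr rfl fun i hi => by rw [Finset.mem_range] at hi; omega
    have e2 : ∑ i ∈ Finset.range m, ((m - i) + (i - m)) = ∑ i ∈ Finset.range m, (m - i) :=
      Finset.sum_congr rfl fun i hi => by rw [Finset.mem_range] at hi; omega
    simp only [Finset.sum_range_succ, Finset.sum_add_distrib] at *
    have h2 := h1 m
    rcases m with _ | m
    · simp
    · simp only [Nat.add_sub_cancel] at *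
      simp only [Nat.sub_self]
      nlinarith

lemma sum_path_ge {V : Type*} [Fintype V] (T : SimpleGraph V)
    (hconn : T.Connected) (m : ℕ) (φ : T ≃g SimpleGraph.pathGraph (m + 1)) :
    (m + 1) * (m * (m - 1)) ≤ 3 * ∑ e ∈ T.edgeFinset, ∑ f ∈ T.edgeFinset, eDist T e f := by
  rw [← sum_absdiff m]
  apply Nat.mul_le_mul_left
  let ε : Fin m → Sym2 V := fun i => s(φ.symm i.castSucc, φ.symm i.succ)
  have hmem : ∀ i x, x ∈ ε i → (φ x : ℕ) = i ∨ (φ x : ℕ) = i + 1 := by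
    intro i x hx
    simp only [ε, Sym2.mem_iff] at hx
    rcases hx with rfl | rfl <;> simp
  have hε : Function.Injective ε := by
    intro i j hij
    have a1 := hmem j (φ.symm i.castSucc) (by rw [← hij]; simp [ε])
    have a2 := hmem j (φ.symm i.succ) (by rw [← hij]; simp [ε])
    simp at a1 a2
    apply Fin.ext
    omega
  have hd : ∀ i j : Fin m, ((i : ℕ) - j) + (j - i) ≤ eDist T (ε i) (ε j) := by
    intro i j
    unfold eDist
    split_ifs with h
    · have := hε h
      simp [this]
    · have hne : {n : ℕ | ∃ u ∈ ε i, ∃ w ∈ ε j, T.dist u w = n}.Nonempty :=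
        ⟨_, _, Sym2.mem_mk_left _ _, _, Sym2.mem_mk_left _ _, rfl⟩
      obtain ⟨u, hu, w, hw, h2⟩ := Nat.sInf_mem hne
      rw [← h2]
      obtain ⟨p, hp⟩ := hconn.exists_walk_length_eq_dist u w
      rw [← hp]
      have := walk_length_ge φ p
      have := hmem i u hu
      have := hmem j w hw
      omega
  have hsub : Finset.univ.image ε ⊆ T.edgeFinset := by
    intro e he
    simp only [Finset.mem_image, Finset.mem_univ, true_and] at he
    obtain ⟨i, rfl⟩ := he
    rw [mem_edgeFinset]
    simp only [ε, mem_edgeSet]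
    rw [φ.symm.map_adj_iff, pathGraph_adj]
    simp
  calc ∑ i ∈ Finset.range m, ∑ j ∈ Finset.range m, ((i - j) + (j - i))
      = ∑ i : Fin m, ∑ j : Fin m, (((i : ℕ) - j) + (j - i)) := by
        rw [Finset.sum_range]
        refine Finset.sum_congr rfl fun i _ => ?_
        rw [Finset.sum_range]
    _ ≤ ∑ i : Fin m, ∑ j : Fin m, eDist T (ε i) (ε j) :=
        Finset.sum_le_sum fun i _ => Finset.sum_le_sum fun j _ => hd i j
    _ = ∑ e ∈ Finset.univ.image ε, ∑ f ∈ Finset.univ.image ε, eDist T e f := by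
        rw [Finset.sum_image hε.injOn]
        refine Finset.sum_congr rfl fun i _ => ?_
        rw [Finset.sum_image hε.injOn]
    _ ≤ ∑ e ∈ Finset.univ.image ε, ∑ f ∈ T.edgeFinset, eDist T e f :=
        Finset.sum_le_sum fun i _ => Finset.sum_le_sum_of_subset hsub
    _ ≤ _ := Finset.sum_le_sum_of_subset hsub

theorem stmt18 {V : Type*} [Fintype V] (T : SimpleGraph V)
    (hconn : T.Connected) (hac : T.IsAcyclic) (hn : 2 ≤ Fintype.card V) :
    ((edgeWiener T : ℚ) ≤ (Fintype.card V : ℚ) * ((Fintype.card V : ℚ) - 1)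
        * ((Fintype.card V : ℚ) - 2) / 6) ∧
      ((edgeWiener T : ℚ) = (Fintype.card V : ℚ) * ((Fintype.card V : ℚ) - 1)
          * ((Fintype.card V : ℚ) - 2) / 6 ↔
        Nonempty (T ≃g SimpleGraph.pathGraph (Fintype.card V))) := by
  obtain ⟨hle, heq⟩ := sum_bound T hconn hac hn
  have hpath : Nonempty (T ≃g SimpleGraph.pathGraph (Fintype.card V)) →
      Fintype.card V * ((Fintype.card V - 1) * (Fintype.card V - 2)) ≤
        3 * ∑ e ∈ T.edgeFinset, ∑ f ∈ T.edgeFinset, eDist T e f := by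
    rintro ⟨φ⟩
    obtain ⟨m, hm⟩ : ∃ m, Fintype.card V = m + 1 := ⟨Fintype.card V - 1, by omega⟩
    rw [hm] at φ ⊢
    exact sum_path_ge T hconn m φ
  have hcollinear := path_of_collinear T hconn hac hn
  unfold edgeWiener
  set S := ∑ e ∈ T.edgeFinset, ∑ f ∈ T.edgeFinset, eDist T e f with hS
  set n := Fintype.card V with hN
  obtain ⟨k, hk⟩ : ∃ k, n = k + 2 := ⟨n - 2, by omega⟩
  have hcast : (n : ℚ) * ((n : ℚ) - 1) * ((n : ℚ) - 2) / 6 = ((n.choose 3 : ℕ) : ℚ) := by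
    have h6 : 6 * n.choose 3 = n * ((n - 1) * (n - 2)) := by
      have := Nat.descFactorial_eq_factorial_mul_choose n 3
      simp [Nat.descFactorial, Nat.factorial] at this
      rw [← this]; ring
    have h7 : ((6 * n.choose 3 : ℕ) : ℚ) = ((n * ((n - 1) * (n - 2)) : ℕ) : ℚ) := by rw [h6]
    rw [hk] at h7 ⊢
    simp only [Nat.add_sub_cancel, show k + 2 - 1 = k + 1 from rfl] at h7
    push_cast at h7 ⊢
    linarith
  have h6 : 6 * n.choose 3 = n * ((n - 1) * (n - 2)) := by
    have := Nat.descFactorial_eq_factorial_mul_choose n 3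
    simp [Nat.descFactorial, Nat.factorial] at this
    rw [← this]; ring
  rw [hcast]
  rw [← h6] at hle heq hpath
  refine ⟨by exact_mod_cast (by omega : S / 2 ≤ n.choose 3), ?_⟩
  rw [Nat.cast_inj]
  constructor
  · intro h
    exact hcollinear (heq (by omega))
  · intro h
    have := hpath h
    omega
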